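/- For every integer r ≥ 1, the polynomial (W²−4X₂Y₂)^r − (X₁²Y₂ + X₂Y₁² + W·X₁Y₁) is irreducible in the polynomial ring ℂ[X₁,X₂,Y₁,Y₂,W]; equivalently, the quotient ring ℂ[X₁,X₂,Y₁,Y₂,W]/((W²−4X₂Y₂)^r − (X₁²Y₂+X₂Y₁²+WX₁Y₁)) is an integral domain. -/

import Mathlib

open MvPolynomial

/-- The polynomial `(W²−4X₂Y₂)^r − (X₁²Y₂ + X₂Y₁² + W·X₁Y₁)` in `ℂ[X₁,X₂,Y₁,Y₂,W]`
(variables indexed `X₁ = 0, X₂ = 1, Y₁ = 2, Y₂ = 3, W = 4`). -/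
noncomputable def coulombPolynomial (r : ℕ) : MvPolynomial (Fin 5) ℂ :=
  ((X 4) ^ 2 - 4 * X 1 * X 3) ^ r
    - ((X 0) ^ 2 * X 3 + X 1 * (X 2) ^ 2 + X 4 * X 0 * X 2)

lemma irr_key {R S : Type*} [CommRing R] [IsDomain R] [CommRing S] [IsDomain S] (φ : R →+* S)
    (p : Polynomial R) (hl : Irreducible p.leadingCoeff) (h1 : φ p.leadingCoeff ≠ 0)
    (h2 : ¬ IsUnit (φ p.leadingCoeff)) (h : Irreducible (p.map φ)) : Irreducible p := by
  have main : ∀ g k : Polynomial R, p = g * k → IsUnit (g.map φ) → IsUnit g := by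
    intro g k hgk hu
    have hlc : p.leadingCoeff = g.leadingCoeff * k.leadingCoeff := by
      rw [hgk, Polynomial.leadingCoeff_mul]
    have hg0 : φ g.leadingCoeff ≠ 0 := by
      intro h0
      apply h1
      rw [hlc, map_mul, h0, zero_mul]
    have hd : (g.map φ).natDegree = g.natDegree :=
      Polynomial.natDegree_map_of_leadingCoeff_ne_zero φ hg0
    rw [Polynomial.natDegree_eq_zero_of_isUnit hu] at hd
    obtain ⟨a, rfl⟩ := Polynomial.natDegree_eq_zero.mp hd.symm
    rw [Polynomial.leadingCoeff_C] at hlc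
    rw [Polynomial.map_C, Polynomial.isUnit_C] at hu
    rw [Polynomial.isUnit_C]
    rcases hl.isUnit_or_isUnit hlc with ha | hk
    · exact ha
    · exact absurd (by rw [hlc, map_mul]; exact hu.mul (hk.map φ)) h2
  refine ⟨fun hu => h.not_isUnit (hu.map (Polynomial.mapRingHom φ)), ?_⟩
  intro g k hgk
  have := h.isUnit_or_isUnit (a := g.map φ) (b := k.map φ) (by rw [hgk, Polynomial.map_mul])
  rcases this with hu | hu
  · exact Or.inl (main g k hgk hu)
  · exact Or.inr (main k g (by rw [hgk, mul_comm]) hu)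

lemma irr_base : Irreducible
    (Polynomial.C (-Polynomial.X) * Polynomial.X ^ 2 + Polynomial.C (-1) * Polynomial.X
      + Polynomial.C 1 : Polynomial (Polynomial ℂ)) := by
  rw [← MulEquiv.irreducible_iff (Polynomial.Bivariate.swap (R := ℂ))]
  have h : Polynomial.Bivariate.swap (R := ℂ) (Polynomial.C (-Polynomial.X) * Polynomial.X ^ 2
      + Polynomial.C (-1) * Polynomial.X + Polynomial.C 1 : Polynomial (Polynomial ℂ))
      = Polynomial.C (-Polynomial.X ^ 2) * Polynomial.X + Polynomial.C (1 - Polynomial.X) := by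
    simp [Polynomial.Bivariate.swap_X, Polynomial.Bivariate.swap_Y]
    ring
  rw [h]
  apply Polynomial.irreducible_C_mul_X_add_C
  · simp
  · apply IsCoprime.isRelPrime
    exact ⟨-1, 1 + Polynomial.X, by ring⟩

theorem coulombPolynomial_irreducible (r : ℕ) (hr : 1 ≤ r) :
    Irreducible (coulombPolynomial r) ∧
      IsDomain (MvPolynomial (Fin 5) ℂ ⧸ Ideal.span {coulombPolynomial r}) := by
  have hirr : Irreducible (coulombPolynomial r) := by
    rw [← MulEquiv.irreducible_iff (finSuccEquiv ℂ 4)]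
    have h : finSuccEquiv ℂ 4 (coulombPolynomial r) =
        Polynomial.C (-X 2) * Polynomial.X ^ 2 + Polynomial.C (-(X 3 * X 1)) * Polynomial.X
        + Polynomial.C ((X 3 ^ 2 - 4 * X 0 * X 2) ^ r - X 0 * X 1 ^ 2) := by
      have e0 : finSuccEquiv ℂ 4 (X 0) = Polynomial.X := finSuccEquiv_X_zero
      have e1 : finSuccEquiv ℂ 4 (X 1) = Polynomial.C (X 0) := finSuccEquiv_X_succ (j := 0)
      have e2 : finSuccEquiv ℂ 4 (X 2) = Polynomial.C (X 1) := finSuccEquiv_X_succ (j := 1)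
      have e3 : finSuccEquiv ℂ 4 (X 3) = Polynomial.C (X 2) := finSuccEquiv_X_succ (j := 2)
      have e4 : finSuccEquiv ℂ 4 (X 4) = Polynomial.C (X 3) := finSuccEquiv_X_succ (j := 3)
      have e5 : (Polynomial.C (4 : MvPolynomial (Fin 4) ℂ)) = 4 := rfl
      simp only [coulombPolynomial, map_sub, map_add, map_mul, map_pow, map_neg, e0, e1, e2, e3,
        e4, map_ofNat, e5]
      ring
    rw [h]
    have hX : (-X 2 : MvPolynomial (Fin 4) ℂ) ≠ 0 := neg_ne_zero.mpr (X_ne_zero 2)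
    let φ : MvPolynomial (Fin 4) ℂ →+* Polynomial ℂ :=
      (aeval ![0, 1, Polynomial.X, 1] : MvPolynomial (Fin 4) ℂ →ₐ[ℂ] Polynomial ℂ)
    have f0 : φ (X 0) = 0 := by simp [φ]
    have f1 : φ (X 1) = 1 := by simp [φ]
    have f2 : φ (X 2) = Polynomial.X := by simp [φ]
    have f3 : φ (X 3) = 1 := by simp [φ]
    apply irr_key φ
    · rw [Polynomial.leadingCoeff_quadratic hX]
      exact (MvPolynomial.X_prime (R := ℂ) (i := (2 : Fin 4))).neg.irreducible
    · rw [Polynomial.leadingCoeff_quadratic hX, map_neg, f2]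
      exact neg_ne_zero.mpr Polynomial.X_ne_zero
    · rw [Polynomial.leadingCoeff_quadratic hX, map_neg, f2, IsUnit.neg_iff]
      exact Polynomial.not_isUnit_X
    · convert irr_base using 1
      simp [f0, f1, f2, f3]
      ring
  refine ⟨hirr, ?_⟩
  have : (Ideal.span {coulombPolynomial r}).IsPrime :=
    (Ideal.span_singleton_prime hirr.ne_zero).mpr hirr.prime
  exact Ideal.Quotient.isDomain _
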